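/- arXiv:2605.09569 — 4 statements merged into one kernel-verified Lean document; each statement's English description precedes it below -/
import Mathlib

section
/- (Analysis of the linear test.) Let α ∈ (0,1). There exist constants C_μ > 0 and C_h > 0 depending only on α such that for all positive integers d₁, d₂, all integers 1 ≤ s₁ ≤ d₁, 1 ≤ s₂ ≤ d₂, and every μ > 0 with μ² ≥ C_μ·d₁d₂/(s₁²s₂²), the linear test Δ(Y) = 1{ (d₁d₂)^{−1/2}·Σ_{i=1}^{d₁}Σ_{j=1}^{d₂} Y_{ij} > C_h } satisfies R(Δ,μ) ≤ α. -/
open MeasureTheory ProbabilityTheory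

noncomputable def Pmeas (d₁ d₂ : ℕ) (X : Fin d₁ → Fin d₂ → ℝ) :
    Measure (Fin d₁ → Fin d₂ → ℝ) :=
  Measure.pi fun i => Measure.pi fun j => gaussianReal (X i j) 1

def Theta (d₁ d₂ s₁ s₂ : ℕ) (μ : ℝ) : Set (Fin d₁ → Fin d₂ → ℝ) :=
  {X | ∃ (S₁ : Finset (Fin d₁)) (S₂ : Finset (Fin d₂)),
    S₁.card = s₁ ∧ S₂.card = s₂ ∧
    (∀ i j, i ∈ S₁ → j ∈ S₂ → μ ≤ X i j) ∧
    (∀ i j, ¬(i ∈ S₁ ∧ j ∈ S₂) → X i j = 0)}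

noncomputable def risk (d₁ d₂ s₁ s₂ : ℕ) (μ : ℝ)
    (Δ : (Fin d₁ → Fin d₂ → ℝ) → Bool) : ℝ :=
  (Pmeas d₁ d₂ 0 {y | Δ y = true}).toReal +
    ⨆ X ∈ Theta d₁ d₂ s₁ s₂ μ, (Pmeas d₁ d₂ X {y | Δ y = false}).toReal

noncomputable def muStar (η : ℝ) (d₁ d₂ s₁ s₂ : ℕ) : ℝ :=
  sInf {μ : ℝ | 0 < μ ∧ ∃ Δ : (Fin d₁ → Fin d₂ → ℝ) → Bool,
    Measurable Δ ∧ risk d₁ d₂ s₁ s₂ μ Δ < η}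


instance (d₁ d₂ : ℕ) (X : Fin d₁ → Fin d₂ → ℝ) : IsProbabilityMeasure (Pmeas d₁ d₂ X) := by
  unfold Pmeas; infer_instance

section SumPi

variable {ι : Type*} [Fintype ι] {Ω : ι → Type*} {mΩ : ∀ i, MeasurableSpace (Ω i)}
  {ν : (i : ι) → Measure (Ω i)} [∀ i, IsProbabilityMeasure (ν i)] {f : (i : ι) → Ω i → ℝ}

lemma memLp_two_sum_pi (h : ∀ i, MemLp (f i) 2 (ν i)) :
    MemLp (fun ω : (i : ι) → Ω i => ∑ i, f i (ω i)) 2 (Measure.pi ν) :=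
  memLp_finsetSum _ fun i _ => (h i).comp_measurePreserving (measurePreserving_eval ν i)

lemma integral_sum_pi (h : ∀ i, MemLp (f i) 2 (ν i)) :
    ∫ ω, ∑ i, f i (ω i) ∂Measure.pi ν = ∑ i, ∫ x, f i x ∂ν i := by
  rw [integral_finsetSum]
  · exact Finset.sum_congr rfl fun i _ => integral_comp_eval (h i).aestronglyMeasurable
  · exact fun i _ =>
      ((h i).comp_measurePreserving (measurePreserving_eval ν i)).integrable one_le_two

lemma variance_fun_sum_pi (h : ∀ i, MemLp (f i) 2 (ν i)) :
    Var[fun ω : (i : ι) → Ω i => ∑ i, f i (ω i); Measure.pi ν] = ∑ i, Var[f i; ν i] := by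
  rw [← variance_sum_pi h]
  congr 1
  ext ω
  simp

end SumPi

lemma memLp_two_fun_id_gaussianReal (m : ℝ) : MemLp (fun x : ℝ => x) 2 (gaussianReal m 1) :=
  memLp_id_gaussianReal' 2 (by simp)

section TotalSum

variable {d₁ d₂ : ℕ} (X : Fin d₁ → Fin d₂ → ℝ)

lemma memLp_two_sum_Pmeas : MemLp (fun Y => ∑ i, ∑ j, Y i j) 2 (Pmeas d₁ d₂ X) :=
  memLp_two_sum_pi fun i => memLp_two_sum_pi fun j => memLp_two_fun_id_gaussianReal (X i j)

lemma integral_sum_Pmeas : ∫ Y, ∑ i, ∑ j, Y i j ∂Pmeas d₁ d₂ X = ∑ i, ∑ j, X i j := by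
  unfold Pmeas
  rw [integral_sum_pi (f := fun (_ : Fin d₁) (y : Fin d₂ → ℝ) => ∑ j, y j)
    fun i => memLp_two_sum_pi fun j => memLp_two_fun_id_gaussianReal (X i j)]
  refine Finset.sum_congr rfl fun i _ => ?_
  rw [integral_sum_pi (f := fun (_ : Fin d₂) (y : ℝ) => y) fun j => memLp_two_fun_id_gaussianReal (X i j)]
  simp only [integral_id_gaussianReal]

lemma variance_sum_Pmeas :
    Var[fun Y => ∑ i, ∑ j, Y i j; Pmeas d₁ d₂ X] = (d₁ : ℝ) * d₂ := by
  unfold Pmeas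
  rw [variance_fun_sum_pi (f := fun (_ : Fin d₁) (y : Fin d₂ → ℝ) => ∑ j, y j)
    fun i => memLp_two_sum_pi fun j => memLp_two_fun_id_gaussianReal (X i j)]
  have h (i : Fin d₁) : Var[fun y : Fin d₂ → ℝ => ∑ j, y j;
      Measure.pi fun j => gaussianReal (X i j) 1] = d₂ := by
    rw [variance_fun_sum_pi (f := fun (_ : Fin d₂) (y : ℝ) => y) fun j => memLp_two_fun_id_gaussianReal (X i j)]
    simp [variance_fun_id_gaussianReal]
  simp [h]

/-- Chebyshev's inequality for the normalised total sum. -/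
lemma Pmeas_le_of_le_abs_sub (hd₁ : 0 < d₁) (hd₂ : 0 < d₂) {c : ℝ} (hc : 0 < c)
    {A : Set (Fin d₁ → Fin d₂ → ℝ)}
    (hA : ∀ Y ∈ A, c * √((d₁ : ℝ) * d₂) ≤ |∑ i, ∑ j, Y i j - ∑ i, ∑ j, X i j|) :
    (Pmeas d₁ d₂ X A).toReal ≤ 1 / c ^ 2 := by
  have hd : (0 : ℝ) < d₁ * d₂ := by positivity
  have h := meas_ge_le_variance_div_sq (memLp_two_sum_Pmeas X)
    (mul_pos hc (Real.sqrt_pos.2 hd))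
  rw [integral_sum_Pmeas, variance_sum_Pmeas, mul_pow, Real.sq_sqrt hd.le] at h
  refine ENNReal.toReal_le_of_le_ofReal (by positivity) ((measure_mono hA).trans (h.trans_eq ?_))
  congr 1
  field_simp

end TotalSum

lemma le_sum_of_mem_Theta {d₁ d₂ s₁ s₂ : ℕ} {μ : ℝ} {X : Fin d₁ → Fin d₂ → ℝ}
    (hX : X ∈ Theta d₁ d₂ s₁ s₂ μ) : (s₁ : ℝ) * s₂ * μ ≤ ∑ i, ∑ j, X i j := by
  obtain ⟨S₁, S₂, rfl, rfl, hle, hzero⟩ := hX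
  have h : ∑ i, ∑ j, X i j = ∑ i ∈ S₁, ∑ j ∈ S₂, X i j := by
    rw [← Finset.sum_subset (Finset.subset_univ S₁)
      fun i _ hi => Finset.sum_eq_zero fun j _ => hzero i j fun h => hi h.1]
    exact Finset.sum_congr rfl fun i _ => (Finset.sum_subset (Finset.subset_univ S₂)
      fun j _ hj => hzero i j fun h => hj h.2).symm
  calc (S₁.card : ℝ) * S₂.card * μ = ∑ _i ∈ S₁, ∑ _j ∈ S₂, μ := by simp [mul_assoc]
    _ ≤ ∑ i ∈ S₁, ∑ j ∈ S₂, X i j :=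
      Finset.sum_le_sum fun i hi => Finset.sum_le_sum fun j hj => hle i j hi hj
    _ = _ := h.symm

/-- Analysis of the linear test (Lemma B.1). -/
theorem linear_test (α : ℝ) (hα0 : 0 < α) (hα1 : α < 1) :
    ∃ Cμ Ch : ℝ, 0 < Cμ ∧ 0 < Ch ∧
      ∀ (d₁ d₂ s₁ s₂ : ℕ), 0 < d₁ → 0 < d₂ →
        1 ≤ s₁ → s₁ ≤ d₁ → 1 ≤ s₂ → s₂ ≤ d₂ →
        ∀ μ : ℝ, 0 < μ →
          Cμ * ((d₁ : ℝ) * (d₂ : ℝ) / ((s₁ : ℝ) ^ 2 * (s₂ : ℝ) ^ 2)) ≤ μ ^ 2 →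
          risk d₁ d₂ s₁ s₂ μ
            (fun Y => decide (Ch <
              (1 / Real.sqrt ((d₁ : ℝ) * (d₂ : ℝ))) * ∑ i, ∑ j, Y i j)) ≤ α := by
  have hc : 0 < √(2 / α) := Real.sqrt_pos.2 (by positivity)
  have hsq : √(2 / α) ^ 2 = 2 / α := Real.sq_sqrt (by positivity)
  have hhalf : 1 / √(2 / α) ^ 2 = α / 2 := by rw [hsq]; field_simp
  refine ⟨4 * √(2 / α) ^ 2, √(2 / α), by positivity, hc, ?_⟩
  intro d₁ d₂ s₁ s₂ hd₁ hd₂ hs₁ _ hs₂ _ μ hμ hsignal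
  generalize √(2 / α) = c at *
  have hd : (0 : ℝ) < d₁ * d₂ := by positivity
  have hr : 0 < √((d₁ : ℝ) * d₂) := Real.sqrt_pos.2 hd
  have hiff (Y : Fin d₁ → Fin d₂ → ℝ) : c < 1 / √((d₁ : ℝ) * d₂) * ∑ i, ∑ j, Y i j ↔
      c * √((d₁ : ℝ) * d₂) < ∑ i, ∑ j, Y i j := by
    rw [one_div_mul_eq_div, lt_div_iff₀ hr]
  have hmean : 2 * c * √((d₁ : ℝ) * d₂) ≤ s₁ * s₂ * μ := by
    have hs : (0 : ℝ) < (s₁ : ℝ) ^ 2 * (s₂ : ℝ) ^ 2 := by positivity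
    refine le_of_sq_le_sq ?_ (by positivity)
    rw [← mul_div_assoc, div_le_iff₀ hs] at hsignal
    rw [mul_pow, Real.sq_sqrt hd.le]
    linarith
  unfold risk
  have h₀ : (Pmeas d₁ d₂ 0 {Y | decide (c < 1 / √((d₁ : ℝ) * d₂) * ∑ i, ∑ j, Y i j) = true}).toReal
      ≤ 1 / c ^ 2 := by
    refine Pmeas_le_of_le_abs_sub 0 hd₁ hd₂ hc fun Y hY => ?_
    rw [Set.mem_ofPred_eq, decide_eq_true_iff, hiff] at hY
    simpa using hY.le.trans (le_abs_self _)
  have h₁ : ⨆ X ∈ Theta d₁ d₂ s₁ s₂ μ, (Pmeas d₁ d₂ X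
      {Y | decide (c < 1 / √((d₁ : ℝ) * d₂) * ∑ i, ∑ j, Y i j) = false}).toReal ≤ 1 / c ^ 2 := by
    refine Real.iSup_le (fun X => Real.iSup_le (fun hX => ?_) (by positivity)) (by positivity)
    refine Pmeas_le_of_le_abs_sub X hd₁ hd₂ hc fun Y hY => ?_
    rw [Set.mem_ofPred_eq, decide_eq_false_iff_not, hiff, not_lt] at hY
    rw [abs_sub_comm]
    refine le_trans ?_ (le_abs_self _)
    linarith [le_sum_of_mem_Theta hX]
  linarith
end

section
/- (Analysis of the Bonferroni-corrected linear test.) Let α ∈ (0,1). There exists a constant C_μ > 0 depending only on α such that for all positive integers d₁, d₂, all integers 1 ≤ s₁ ≤ d₁, 1 ≤ s₂ ≤ d₂, and every μ > 0 with μ² ≥ C_μ·(d₂/(s₁s₂²))·log(e·C(d₁,s₁)), the test Δ(Y) = 1{ max_{J₁ ⊆ {1,…,d₁}, |J₁| = s₁} (1/√d₂)·Σ_{j=1}^{d₂} (1/√s₁)·Σ_{i∈J₁} Y_{ij} > h }, with threshold h = max( √(2/α), √(2·log((2e/α)·C(d₁,s₁))) ), satisfies R(Δ,μ) ≤ α.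 -/
open MeasureTheory ProbabilityTheory

open scoped NNReal

instance inst_s9 (d₁ d₂ : ℕ) (X : Fin d₁ → Fin d₂ → ℝ) : IsProbabilityMeasure (Pmeas d₁ d₂ X) := by
  unfold Pmeas; infer_instance

lemma hasSubgaussianMGF_mul_sub_gaussianReal (m w : ℝ) :
    HasSubgaussianMGF (fun y ↦ w * (y - m)) (‖w‖₊ ^ 2) (gaussianReal m 1) := by
  have h : HasSubgaussianMGF (fun y : ℝ ↦ y - m) 1 (gaussianReal m 1) := by
    have hmap : (gaussianReal m 1).map (fun y ↦ y - m) = gaussianReal 0 1 := by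
      simpa using gaussianReal_map_sub_const (μ := m) (v := 1) m
    refine (HasSubgaussianMGF.id_map_iff (by fun_prop)).1 ?_
    rw [hmap]
    exact ⟨fun t ↦ integrable_exp_mul_gaussianReal t, fun t ↦ by simp [mgf_id_gaussianReal]⟩
  convert h.const_mul w using 1
  ext
  change ‖w‖ ^ 2 = w ^ 2 * 1
  simp

lemma HasSubgaussianMGF.sum_pi {ι : Type*} [Fintype ι] {Ω : ι → Type*}
    [∀ i, MeasurableSpace (Ω i)] {P : ∀ i, Measure (Ω i)} [∀ i, IsProbabilityMeasure (P i)]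
    {f : ∀ i, Ω i → ℝ} {c : ι → ℝ≥0} (h : ∀ i, HasSubgaussianMGF (f i) (c i) (P i)) :
    HasSubgaussianMGF (fun ω ↦ ∑ i, f i (ω i)) (∑ i, c i) (Measure.pi P) := by
  refine HasSubgaussianMGF.sum_of_iIndepFun
    (iIndepFun_pi fun i ↦ (h i).aemeasurable) fun i _ ↦ ?_
  have hev := measurePreserving_eval P i
  refine HasSubgaussianMGF.of_map (Y := fun ω : ∀ i, Ω i ↦ ω i) hev.aemeasurable ?_
  rw [hev.map_eq]
  exact h i

lemma Pmeas_real_linear_ge_le {d₁ d₂ : ℕ} (X w : Fin d₁ → Fin d₂ → ℝ) {ε : ℝ} (hε : 0 ≤ ε) :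
    (Pmeas d₁ d₂ X).real {Y | ε ≤ ∑ i, ∑ j, w i j * (Y i j - X i j)} ≤
      Real.exp (-ε ^ 2 / (2 * ∑ i, ∑ j, w i j ^ 2)) := by
  have h : HasSubgaussianMGF (fun Y : Fin d₁ → Fin d₂ → ℝ ↦
      ∑ i, ∑ j, w i j * (Y i j - X i j)) (∑ i, ∑ j, ‖w i j‖₊ ^ 2) (Pmeas d₁ d₂ X) :=
    HasSubgaussianMGF.sum_pi (f := fun i (y : Fin d₂ → ℝ) ↦ ∑ j, w i j * (y j - X i j)) fun i ↦
      HasSubgaussianMGF.sum_pi (f := fun j (y : ℝ) ↦ w i j * (y - X i j)) fun j ↦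
        hasSubgaussianMGF_mul_sub_gaussianReal (X i j) (w i j)
  simpa using h.measure_ge_le hε

/-- The normalized sum of the entries of `Y` in the rows `J`. -/
noncomputable def rowStat (d₁ d₂ s₁ : ℕ) (J : Finset (Fin d₁)) (Y : Fin d₁ → Fin d₂ → ℝ) : ℝ :=
  (1 / Real.sqrt (d₂ : ℝ)) * ∑ j, (1 / Real.sqrt (s₁ : ℝ)) * ∑ i ∈ J, Y i j

/-- The coefficients of the linear functional `rowStat`. -/
noncomputable def rowWeight (d₁ d₂ s₁ : ℕ) (J : Finset (Fin d₁)) (i : Fin d₁) (_ : Fin d₂) : ℝ :=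
  if i ∈ J then (1 / Real.sqrt (d₂ : ℝ)) * (1 / Real.sqrt (s₁ : ℝ)) else 0

lemma rowStat_eq {d₁ d₂ s₁ : ℕ} (J : Finset (Fin d₁)) (Y : Fin d₁ → Fin d₂ → ℝ) :
    rowStat d₁ d₂ s₁ J Y = ∑ i, ∑ j, rowWeight d₁ d₂ s₁ J i j * Y i j := by
  rw [Finset.sum_comm]
  simp [rowStat, rowWeight, Finset.mul_sum, ite_mul, Finset.sum_ite_mem, mul_assoc]

lemma sum_rowWeight_sq {d₁ d₂ s₁ : ℕ} (hd : 0 < d₂) (hs : 0 < s₁) {J : Finset (Fin d₁)}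
    (hJ : J.card = s₁) : ∑ i, ∑ j, rowWeight d₁ d₂ s₁ J i j ^ 2 = 1 := by
  have hd' : (0 : ℝ) < d₂ := by exact_mod_cast hd
  have hs' : (0 : ℝ) < s₁ := by exact_mod_cast hs
  simp [rowWeight, ite_pow, mul_pow, Finset.sum_ite_mem, hJ]
  field_simp

lemma Pmeas_zero_rowStat_ge_le {d₁ d₂ s₁ : ℕ} (hd : 0 < d₂) (hs : 0 < s₁) {J : Finset (Fin d₁)}
    (hJ : J.card = s₁) {h : ℝ} (hh : 0 ≤ h) :
    (Pmeas d₁ d₂ 0).real {Y | h ≤ rowStat d₁ d₂ s₁ J Y} ≤ Real.exp (-h ^ 2 / 2) := by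
  simpa [rowStat_eq, sum_rowWeight_sq hd hs hJ] using
    Pmeas_real_linear_ge_le (0 : Fin d₁ → Fin d₂ → ℝ) (rowWeight d₁ d₂ s₁ J) hh

lemma Pmeas_rowStat_le_le {d₁ d₂ s₁ : ℕ} (hd : 0 < d₂) (hs : 0 < s₁) {J : Finset (Fin d₁)}
    (hJ : J.card = s₁) {X : Fin d₁ → Fin d₂ → ℝ} {h : ℝ} (hh : 0 ≤ h)
    (hX : 2 * h ≤ rowStat d₁ d₂ s₁ J X) :
    (Pmeas d₁ d₂ X).real {Y | rowStat d₁ d₂ s₁ J Y ≤ h} ≤ Real.exp (-h ^ 2 / 2) := by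
  have key := Pmeas_real_linear_ge_le X (fun i j ↦ -rowWeight d₁ d₂ s₁ J i j) hh
  simp only [neg_sq, sum_rowWeight_sq hd hs hJ, mul_one] at key
  refine (measureReal_mono fun Y hY ↦ ?_).trans key
  have : ∑ i, ∑ j, -rowWeight d₁ d₂ s₁ J i j * (Y i j - X i j) =
      rowStat d₁ d₂ s₁ J X - rowStat d₁ d₂ s₁ J Y := by
    simp only [rowStat_eq, ← Finset.sum_sub_distrib]
    exact Finset.sum_congr rfl fun i _ ↦ Finset.sum_congr rfl fun j _ ↦ by ring
  simp only [Set.mem_ofPred_eq, this] at hY ⊢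
  linarith

lemma lt_biSup_finset_iff {ι : Type*} {s : Finset ι} {f : ι → ℝ} {h : ℝ} (hh : 0 ≤ h) :
    (h < ⨆ i ∈ s, f i) ↔ ∃ i ∈ s, h < f i := by
  constructor
  · contrapose!
    exact fun H ↦ Real.iSup_le (fun i ↦ Real.iSup_le (H i) hh) hh
  · rintro ⟨i, hi, hlt⟩
    have hb : BddAbove (Set.range fun i ↦ ⨆ _ : i ∈ s, f i) := by
      refine ⟨∑ i ∈ s, |f i|, ?_⟩
      rintro _ ⟨k, rfl⟩
      have h0 : 0 ≤ ∑ i ∈ s, |f i| := Finset.sum_nonneg fun _ _ ↦ abs_nonneg _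
      exact Real.iSup_le (fun hk ↦ (le_abs_self _).trans
        (Finset.single_le_sum (f := fun i ↦ |f i|) (fun _ _ ↦ abs_nonneg _) hk)) h0
    have := le_ciSup hb i
    simp only [hi, ciSup_unique] at this
    exact hlt.trans_le this

lemma le_rowStat_of_mem_Theta {d₁ d₂ s₁ : ℕ} {S₁ : Finset (Fin d₁)}
    {S₂ : Finset (Fin d₂)} {μ : ℝ} {X : Fin d₁ → Fin d₂ → ℝ} (hS₁ : S₁.card = s₁)
    (hX : ∀ i j, i ∈ S₁ → j ∈ S₂ → μ ≤ X i j) (hX0 : ∀ i j, ¬(i ∈ S₁ ∧ j ∈ S₂) → X i j = 0) :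
    (1 / Real.sqrt d₂) * (S₂.card * ((1 / Real.sqrt s₁) * (s₁ * μ))) ≤
      rowStat d₁ d₂ s₁ S₁ X := by
  have hsum : ∑ j, (1 / Real.sqrt (s₁ : ℝ)) * ∑ i ∈ S₁, X i j =
      ∑ j ∈ S₂, (1 / Real.sqrt (s₁ : ℝ)) * ∑ i ∈ S₁, X i j := by
    refine (Finset.sum_subset (Finset.subset_univ _) fun j _ hj ↦ ?_).symm
    rw [Finset.sum_eq_zero fun i _ ↦ hX0 i j fun h ↦ hj h.2, mul_zero]
  rw [rowStat, hsum, ← nsmul_eq_mul S₂.card]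
  refine mul_le_mul_of_nonneg_left (Finset.card_nsmul_le_sum _ _ _ fun j hj ↦ ?_) (by positivity)
  refine mul_le_mul_of_nonneg_left ?_ (by positivity)
  rw [← hS₁, ← nsmul_eq_mul]
  exact Finset.card_nsmul_le_sum _ _ _ fun i hi ↦ hX i j hi hj

/-- The threshold of the test, with `N` hypotheses in the union bound. -/
noncomputable def threshold (α N : ℝ) : ℝ :=
  max (Real.sqrt (2 / α)) (Real.sqrt (2 * Real.log ((2 * Real.exp 1 / α) * N)))

lemma threshold_nonneg (α N : ℝ) : 0 ≤ threshold α N :=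
  le_max_of_le_left (Real.sqrt_nonneg _)

lemma exp_neg_threshold_sq_le {α N : ℝ} (hα : 0 < α) (hN : 0 < N) :
    Real.exp (-threshold α N ^ 2 / 2) ≤ α / 2 / N := by
  have hlog : 2 * Real.log ((2 * Real.exp 1 / α) * N) ≤ threshold α N ^ 2 :=
    Real.sqrt_le_iff.1 (le_max_right _ _) |>.2
  have he : 1 ≤ Real.exp 1 := Real.one_le_exp zero_le_one
  calc Real.exp (-threshold α N ^ 2 / 2)
      ≤ Real.exp (-Real.log ((2 * Real.exp 1 / α) * N)) := Real.exp_le_exp.2 (by linarith)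
    _ = α / 2 / N / Real.exp 1 := by
        rw [Real.exp_neg, Real.exp_log (by positivity)]; field_simp
    _ ≤ α / 2 / N := div_le_self (by positivity) he

lemma threshold_sq_le {α N : ℝ} (hα : 0 < α) (hα1 : α < 1) (hN : 1 ≤ N) :
    4 * threshold α N ^ 2 ≤
      (8 / α + 8 * (1 + Real.log (2 / α))) * Real.log (Real.exp 1 * N) := by
  have hL : 1 ≤ Real.log (Real.exp 1 * N) := by
    rw [Real.log_mul (by positivity) (by positivity), Real.log_exp]
    linarith [Real.log_nonneg hN]
  have hA : 0 ≤ Real.log (2 / α) := Real.log_nonneg (by rw [le_div_iff₀ hα]; linarith)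
  have hsplit : Real.log ((2 * Real.exp 1 / α) * N) =
      Real.log (2 / α) + Real.log (Real.exp 1 * N) := by
    rw [← Real.log_mul (by positivity) (by positivity)]; congr 1; ring
  have hinv : 0 < 8 / α := by positivity
  have h28 : 4 * (2 / α) = 8 / α := by ring
  rcases max_choice (Real.sqrt (2 / α))
    (Real.sqrt (2 * Real.log ((2 * Real.exp 1 / α) * N))) with h | h
  · rw [threshold, h, Real.sq_sqrt (by positivity), h28]
    nlinarith [mul_nonneg hA (zero_le_one.trans hL)]
  · rw [threshold, h, Real.sq_sqrt (by rw [hsplit]; linarith), hsplit]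
    nlinarith

/-- Analysis of the Bonferroni-corrected linear test (Lemma B.2). -/
theorem max_linear_test (α : ℝ) (hα0 : 0 < α) (hα1 : α < 1) :
    ∃ Cμ : ℝ, 0 < Cμ ∧
      ∀ (d₁ d₂ s₁ s₂ : ℕ), 0 < d₁ → 0 < d₂ →
        1 ≤ s₁ → s₁ ≤ d₁ → 1 ≤ s₂ → s₂ ≤ d₂ →
        ∀ μ : ℝ, 0 < μ →
          Cμ * ((d₂ : ℝ) / ((s₁ : ℝ) * (s₂ : ℝ) ^ 2)) *
              Real.log (Real.exp 1 * (d₁.choose s₁ : ℝ)) ≤ μ ^ 2 →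
          risk d₁ d₂ s₁ s₂ μ
            (fun Y => decide
              (max (Real.sqrt (2 / α))
                  (Real.sqrt (2 * Real.log ((2 * Real.exp 1 / α) *
                    (d₁.choose s₁ : ℝ)))) <
                ⨆ J₁ ∈ (Finset.univ : Finset (Fin d₁)).powersetCard s₁,
                  (1 / Real.sqrt (d₂ : ℝ)) *
                    ∑ j, (1 / Real.sqrt (s₁ : ℝ)) * ∑ i ∈ J₁, Y i j)) ≤ α := by
  have hA : 0 ≤ Real.log (2 / α) := Real.log_nonneg (by rw [le_div_iff₀ hα0]; linarith)
  refine ⟨8 / α + 8 * (1 + Real.log (2 / α)), by positivity, ?_⟩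
  intro d₁ d₂ s₁ s₂ hd₁ hd₂ hs₁ hs₁d hs₂ hs₂d μ hμ hμC
  set N : ℝ := (d₁.choose s₁ : ℝ) with hNdef
  have hN : 1 ≤ N := Nat.one_le_cast.2 (Nat.choose_pos hs₁d)
  change risk d₁ d₂ s₁ s₂ μ (fun Y ↦ decide (threshold α N <
    ⨆ J₁ ∈ (Finset.univ : Finset (Fin d₁)).powersetCard s₁, rowStat d₁ d₂ s₁ J₁ Y)) ≤ α
  have hh := threshold_nonneg α N
  have hexp := exp_neg_threshold_sq_le hα0 (zero_lt_one.trans_le hN)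
  have htype1 : (Pmeas d₁ d₂ 0).real {Y | threshold α N <
      ⨆ J₁ ∈ (Finset.univ : Finset (Fin d₁)).powersetCard s₁, rowStat d₁ d₂ s₁ J₁ Y}
      ≤ α / 2 := by
    calc _ ≤ (Pmeas d₁ d₂ 0).real (⋃ J ∈ (Finset.univ : Finset (Fin d₁)).powersetCard s₁,
            {Y | threshold α N ≤ rowStat d₁ d₂ s₁ J Y}) := by
          refine measureReal_mono (fun Y hY ↦ ?_) (measure_ne_top _ _)
          obtain ⟨J, hJ, hlt⟩ := (lt_biSup_finset_iff hh).1 hY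
          exact Set.mem_biUnion (Finset.mem_coe.2 hJ) hlt.le
      _ ≤ ∑ J ∈ (Finset.univ : Finset (Fin d₁)).powersetCard s₁,
            (Pmeas d₁ d₂ 0).real {Y | threshold α N ≤ rowStat d₁ d₂ s₁ J Y} :=
          measureReal_biUnion_finset_le _ _
      _ ≤ ∑ _J ∈ (Finset.univ : Finset (Fin d₁)).powersetCard s₁, α / 2 / N :=
          Finset.sum_le_sum fun J hJ ↦ (Pmeas_zero_rowStat_ge_le hd₂ hs₁
            (Finset.mem_powersetCard.1 hJ).2 hh).trans hexp
      _ = α / 2 := by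
          rw [Finset.sum_const, Finset.card_powersetCard, Finset.card_univ, Fintype.card_fin,
            nsmul_eq_mul, ← hNdef]
          field_simp
  have htype2 (X : Fin d₁ → Fin d₂ → ℝ) (hX : X ∈ Theta d₁ d₂ s₁ s₂ μ) :
      (Pmeas d₁ d₂ X).real {Y | ¬ threshold α N <
        ⨆ J₁ ∈ (Finset.univ : Finset (Fin d₁)).powersetCard s₁, rowStat d₁ d₂ s₁ J₁ Y}
        ≤ α / 2 := by
    obtain ⟨S₁, S₂, hS₁, hS₂, hXμ, hX0⟩ := hX
    have hmean : 2 * threshold α N ≤ rowStat d₁ d₂ s₁ S₁ X := by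
      refine le_trans (le_of_sq_le_sq ?_ (by positivity))
        (le_rowStat_of_mem_Theta hS₁ hXμ hX0)
      have hd' : (0 : ℝ) < d₂ := by exact_mod_cast hd₂
      have hs' : (0 : ℝ) < s₁ := by exact_mod_cast hs₁
      have hs₂' : (0 : ℝ) < s₂ := by exact_mod_cast hs₂
      have hk : (0 : ℝ) < s₁ * s₂ ^ 2 / d₂ := by positivity
      calc (2 * threshold α N) ^ 2 = 4 * threshold α N ^ 2 := by ring
        _ ≤ _ := threshold_sq_le hα0 hα1 hN
        _ = (s₁ * s₂ ^ 2 / d₂) * ((8 / α + 8 * (1 + Real.log (2 / α))) *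
            ((d₂ : ℝ) / ((s₁ : ℝ) * (s₂ : ℝ) ^ 2)) * Real.log (Real.exp 1 * N)) := by
          field_simp
        _ ≤ (s₁ * s₂ ^ 2 / d₂) * μ ^ 2 := mul_le_mul_of_nonneg_left hμC hk.le
        _ = _ := by
          simp only [hS₂, mul_pow, div_pow, Real.sq_sqrt hd'.le, Real.sq_sqrt hs'.le]
          field_simp
    calc _ ≤ (Pmeas d₁ d₂ X).real {Y | rowStat d₁ d₂ s₁ S₁ Y ≤ threshold α N} := by
          refine measureReal_mono fun Y hY ↦ ?_
          by_contra hlt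
          exact hY ((lt_biSup_finset_iff hh).2 ⟨S₁, by simp [hS₁], not_le.1 hlt⟩)
      _ ≤ α / 2 / N := (Pmeas_rowStat_le_le hd₂ hs₁ hS₁ hh hmean).trans hexp
      _ ≤ α / 2 := div_le_self (by positivity) hN
  have h2 : ⨆ X ∈ Theta d₁ d₂ s₁ s₂ μ, (Pmeas d₁ d₂ X).real {Y | ¬ threshold α N <
        ⨆ J₁ ∈ (Finset.univ : Finset (Fin d₁)).powersetCard s₁, rowStat d₁ d₂ s₁ J₁ Y}
        ≤ α / 2 :=
    Real.iSup_le (fun X ↦ Real.iSup_le (htype2 X) (by positivity)) (by positivity)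
  simp only [risk, decide_eq_true_eq, decide_eq_false_iff_not]
  exact (add_le_add htype1 h2).trans (by linarith)
end

section
/- (Analysis of the truncated χ² test.) Let α ∈ (0,1) and let c > 0 be a constant. Set C₀ = max( 1/log(1+c), 2 ). There exist constants C_μ, C_h > 0 depending only on α and c such that for all positive integers d₁, d₂, all integers 1 ≤ s₁ ≤ d₁, 1 ≤ s₂ ≤ d₂ with d₂/s₂² ≥ c, and every μ > 0 with μ² ≥ C_μ·(d₁/s₁²)·log(1 + d₂/s₂²), the test Δ(Y) = 1{ Σ_{j=1}^{d₂} ((Ȳ_j)² − ν_{τ*})·1(|Ȳ_j| > τ*) > C_h·s₂·log(1 + d₂/s₂²) }, where Ȳ_j = d₁^{−1/2}·Σ_{i=1}^{d₁} Y_{ij} and τ* = √(C₀·log(1 + d₂/s₂²)), satisfies R(Δ,μ) ≤ α. -/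
open MeasureTheory ProbabilityTheory

/-- ν_τ = E[Z² | |Z| > τ] for Z ~ N(0,1). -/
noncomputable def nuTau (τ : ℝ) : ℝ :=
  (∫ z in {z : ℝ | τ < |z|}, z ^ 2 ∂(gaussianReal 0 1)) /
    ((gaussianReal 0 1) {z : ℝ | τ < |z|}).toReal

theorem measure_pi_pi_map_transpose {ι κ : Type*} [Fintype ι] [Fintype κ]
    (m : ι → κ → Measure ℝ) [∀ i j, IsProbabilityMeasure (m i j)] :
    (Measure.pi fun i => Measure.pi fun j => m i j).map (fun Y j i => Y i j) =
      Measure.pi fun j => Measure.pi fun i => m i j := by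
  symm
  have hmeas : Measurable (fun (Y : ι → κ → ℝ) j i => Y i j) := by fun_prop
  refine Measure.pi_eq_generateFrom
    (C := fun _ => Set.pi Set.univ '' Set.pi Set.univ fun _ => {s : Set ℝ | MeasurableSet s})
    (fun _ => generateFrom_pi) (fun _ => isPiSystem_pi)
    (fun _ => ⟨fun _ => Set.univ, fun _ => ⟨fun _ => Set.univ, by simp, by simp⟩,
      fun _ => by simp, Set.iUnion_const _⟩) ?_
  intro s hs
  choose t ht hts using hs
  obtain rfl : (fun j => Set.pi Set.univ (t j)) = s := funext hts
  have hpre : (fun (Y : ι → κ → ℝ) j i => Y i j) ⁻¹'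
      Set.pi Set.univ (fun j => Set.pi Set.univ (t j)) =
      Set.pi Set.univ (fun i => Set.pi Set.univ (fun j => t j i)) := by
    ext Y
    simp only [Set.mem_preimage, Set.mem_pi, Set.mem_univ, forall_true_left]
    exact forall_comm
  rw [Measure.map_apply hmeas, hpre]
  · simp only [Measure.pi_pi]
    exact Finset.prod_comm
  · exact MeasurableSet.univ_pi fun j => MeasurableSet.univ_pi fun i => ht j i trivial

theorem measure_pi_gaussianReal_map_scaled_sum {ι : Type*} [Fintype ι] [Nonempty ι] (x : ι → ℝ) :
    (Measure.pi fun i => gaussianReal (x i) 1).map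
        (fun Z => (1 / √(Fintype.card ι : ℝ)) * ∑ i, Z i) =
      gaussianReal ((1 / √(Fintype.card ι : ℝ)) * ∑ i, x i) 1 := by
  have hev : ∀ i, HasGaussianLaw (fun Z : ι → ℝ => Z i)
      (Measure.pi fun i => gaussianReal (x i) 1) := fun i => ⟨by
    rw [(measurePreserving_eval (fun i => gaussianReal (x i) 1) i).map_eq]
    infer_instance⟩
  have hind : iIndepFun (fun (i : ι) (Z : ι → ℝ) => Z i)
      (Measure.pi fun i => gaussianReal (x i) 1) :=
    iIndepFun_pi (X := fun _ z => z) fun i => by fun_prop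
  have hsum := (hind.hasGaussianLaw_sum hev).fun_smul (1 / √(Fintype.card ι : ℝ))
  have hfun : (fun Z => (1 / √(Fintype.card ι : ℝ)) • (∑ i, fun Z : ι → ℝ => Z i) Z) =
      fun Z => (1 / √(Fintype.card ι : ℝ)) * ∑ i, Z i := by
    ext Z; simp [Finset.mul_sum]
  rw [hfun] at hsum
  have hvar : Var[fun Z => ∑ i, Z i; Measure.pi fun i => gaussianReal (x i) 1] =
      Fintype.card ι := by
    have := variance_sum_pi (μ := fun i => gaussianReal (x i) 1) (X := fun _ z => z)
      (fun i => memLp_id_gaussianReal 2)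
    have h2 : (∑ i, fun Z : ι → ℝ => Z i) = fun Z => ∑ i, Z i := by ext; simp
    rw [h2] at this
    rw [this]
    simp [variance_fun_id_gaussianReal]
  have hc : (0 : ℝ) < Fintype.card ι := by exact_mod_cast Fintype.card_pos
  rw [hsum.map_eq_gaussianReal, variance_const_mul, hvar, integral_const_mul, integral_finsetSum]
  · congr 2
    · refine Finset.sum_congr rfl fun i _ => ?_
      rw [integral_comp_eval (μ := fun i => gaussianReal (x i) 1) (f := fun z => z)
        (by fun_prop)]
      exact integral_id_gaussianReal
    · rw [div_pow, Real.sq_sqrt hc.le, one_pow, one_div, inv_mul_cancel₀ hc.ne']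
      simp
  · exact fun i _ => (hev i).integrable

theorem Pmeas_map_scaled_column_sums {d₁ d₂ : ℕ} (hd₁ : 0 < d₁) (X : Fin d₁ → Fin d₂ → ℝ) :
    (Pmeas d₁ d₂ X).map (fun Y j => (1 / √(d₁ : ℝ)) * ∑ i, Y i j) =
      Measure.pi fun j => gaussianReal ((1 / √(d₁ : ℝ)) * ∑ i, X i j) 1 := by
  have : NeZero d₁ := ⟨hd₁.ne'⟩
  have hcomp : (fun (Y : Fin d₁ → Fin d₂ → ℝ) j => (1 / √(d₁ : ℝ)) * ∑ i, Y i j) =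
      (fun (Z : Fin d₂ → Fin d₁ → ℝ) j => (1 / √(d₁ : ℝ)) * ∑ i, Z j i) ∘
        (fun Y j i => Y i j) := rfl
  have hcol := fun j => measure_pi_gaussianReal_map_scaled_sum (fun i => X i j)
  simp only [Fintype.card_fin] at hcol
  have hm : ∀ j : Fin d₂, AEMeasurable (fun z : Fin d₁ → ℝ => (1 / √(d₁ : ℝ)) * ∑ i, z i)
      (Measure.pi fun i => gaussianReal (X i j) 1) := fun j => by fun_prop
  have : ∀ j, SigmaFinite ((Measure.pi fun i => gaussianReal (X i j) 1).map
      (fun z : Fin d₁ → ℝ => (1 / √(d₁ : ℝ)) * ∑ i, z i)) := fun j => by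
    rw [hcol]; infer_instance
  rw [hcomp, ← Measure.map_map (by fun_prop) (by fun_prop), Pmeas, measure_pi_pi_map_transpose,
    Measure.pi_map_pi hm]
  simp only [hcol]

theorem gaussianPDFReal_zero_one (x : ℝ) :
    gaussianPDFReal 0 1 x = (√(2 * Real.pi))⁻¹ * Real.exp (-(1 / 2) * x ^ 2) := by
  simp only [gaussianPDFReal, NNReal.coe_one]
  congr 2
  · simp
  · ring

theorem integrable_polynomial_mul_gaussianPDFReal (p : Polynomial ℝ) :
    Integrable fun x : ℝ => p.eval x * gaussianPDFReal 0 1 x := by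
  induction p using Polynomial.induction_on' with
  | add p q hp hq =>
    refine (hp.add hq).congr (ae_of_all _ fun x => ?_)
    simp [add_mul]
  | monomial n a =>
    have h := integrable_rpow_mul_exp_neg_mul_sq (b := 1 / 2) (by norm_num) (s := n)
      (by have := n.cast_nonneg (α := ℝ); linarith)
    refine (h.const_mul (a * (√(2 * Real.pi))⁻¹)).congr (ae_of_all _ fun x => ?_)
    simp only [gaussianPDFReal_zero_one, Polynomial.eval_monomial, Real.rpow_natCast]
    ring

theorem tendsto_polynomial_mul_gaussianPDFReal (p : Polynomial ℝ) :
    Filter.Tendsto (fun x : ℝ => p.eval x * gaussianPDFReal 0 1 x) Filter.atTop (nhds 0) := by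
  have h := p.tendsto_div_exp_atTop
  have h' : Filter.Tendsto (fun x => (√(2 * Real.pi))⁻¹ * |p.eval x / Real.exp x|) Filter.atTop (nhds 0) := by
    convert h.abs.const_mul (√(2 * Real.pi))⁻¹ using 2
    simp
  refine squeeze_zero_norm' ?_ h'
  filter_upwards [Filter.eventually_ge_atTop (2 : ℝ)] with x hx
  rw [gaussianPDFReal_zero_one, Real.norm_eq_abs, abs_mul, abs_mul, abs_div,
    abs_of_pos (Real.exp_pos _), abs_of_pos (Real.exp_pos _),
    abs_of_nonneg (a := (√(2 * Real.pi))⁻¹) (by positivity),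
    div_eq_mul_inv |p.eval x|, ← Real.exp_neg]
  have : Real.exp (-(1 / 2) * x ^ 2) ≤ Real.exp (-x) := Real.exp_le_exp.2 (by nlinarith)
  have h0 : 0 ≤ |p.eval x| * (√(2 * Real.pi))⁻¹ := by positivity
  nlinarith [mul_le_mul_of_nonneg_left this h0]

theorem hasDerivAt_gaussianPDFReal_zero_one (x : ℝ) :
    HasDerivAt (gaussianPDFReal 0 1) (-x * gaussianPDFReal 0 1 x) x := by
  have h : HasDerivAt (fun x : ℝ => (√(2 * Real.pi))⁻¹ * Real.exp (-(1 / 2) * x ^ 2))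
      ((√(2 * Real.pi))⁻¹ * (Real.exp (-(1 / 2) * x ^ 2) * (-(1 / 2) * (2 * x)))) x := by
    simpa using ((((hasDerivAt_id x).pow 2).const_mul (-(1 / 2) : ℝ)).exp).const_mul
      (√(2 * Real.pi))⁻¹
  rw [funext gaussianPDFReal_zero_one]
  convert h using 1
  ring

theorem setIntegral_gaussianReal_comp_abs {τ : ℝ} (hτ : 0 ≤ τ) (g : ℝ → ℝ) :
    ∫ z in {z : ℝ | τ < |z|}, g |z| ∂(gaussianReal 0 1) =
      2 * ∫ x in Set.Ioi τ, g x * gaussianPDFReal 0 1 x := by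
  have hS : MeasurableSet {z : ℝ | τ < |z|} := measurableSet_lt (by fun_prop) (by fun_prop)
  rw [← integral_indicator hS, integral_gaussianReal_eq_integral_smul one_ne_zero]
  have h : ∀ z : ℝ, gaussianPDFReal 0 1 z •
      ({z : ℝ | τ < |z|}.indicator (fun z => g |z|) z) =
      (Set.Ioi τ).indicator (fun x => g x * gaussianPDFReal 0 1 x) |z| := fun z => by
    by_cases hz : τ < |z|
    · simp [Set.indicator, hz, gaussianPDFReal_zero_one, mul_comm]
    · simp [Set.indicator, hz]
  simp only [h]
  rw [integral_comp_abs, setIntegral_indicator measurableSet_Ioi,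
    Set.inter_eq_self_of_subset_right (Set.Ioi_subset_Ioi hτ)]

/-- Gaussian integration by parts on the two-sided tail. -/
theorem setIntegral_gaussianReal_stein {τ : ℝ} (hτ : 0 ≤ τ) (p : Polynomial ℝ) :
    ∫ z in {z : ℝ | τ < |z|}, (|z| * p.eval |z| - p.derivative.eval |z|) ∂(gaussianReal 0 1) =
      2 * (p.eval τ * gaussianPDFReal 0 1 τ) := by
  rw [setIntegral_gaussianReal_comp_abs hτ fun x => x * p.eval x - p.derivative.eval x]
  congr 1
  have hd : ∀ x ∈ Set.Ici τ, HasDerivAt (fun x => -(p.eval x * gaussianPDFReal 0 1 x))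
      ((x * p.eval x - p.derivative.eval x) * gaussianPDFReal 0 1 x) x := fun x _ => by
    refine ((p.hasDerivAt x).mul (hasDerivAt_gaussianPDFReal_zero_one x)).neg.congr_deriv ?_
    ring
  have hi : Integrable fun x : ℝ =>
      (x * p.eval x - p.derivative.eval x) * gaussianPDFReal 0 1 x := by
    refine (integrable_polynomial_mul_gaussianPDFReal
      (Polynomial.X * p - Polynomial.derivative p)).congr (ae_of_all _ fun x => ?_)
    simp
  rw [integral_Ioi_of_hasDerivAt_of_tendsto' hd hi.integrableOn
    (by simpa using (tendsto_polynomial_mul_gaussianPDFReal p).neg)]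
  ring

theorem integrable_abs_pow_gaussianReal (m : ℝ) (n : ℕ) :
    Integrable (fun z : ℝ => |z| ^ n) (gaussianReal m 1) := by
  have := (memLp_id_gaussianReal (μ := m) (v := 1) n).integrable_norm_pow'
  simpa using this

theorem setIntegral_sq_gaussianReal_le {τ : ℝ} (hτ : 0 ≤ τ) :
    ∫ z in {z : ℝ | τ < |z|}, z ^ 2 ∂(gaussianReal 0 1) ≤
      (τ ^ 2 + 2) * ((gaussianReal 0 1) {z : ℝ | τ < |z|}).toReal := by
  have hst := setIntegral_gaussianReal_stein hτ (Polynomial.X - Polynomial.C τ)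
  simp only [Polynomial.eval_sub, Polynomial.eval_X, Polynomial.eval_C,
    Polynomial.derivative_sub, Polynomial.derivative_X, Polynomial.derivative_C, sub_self,
    zero_mul, mul_zero, Polynomial.eval_one, sub_zero] at hst
  have i1 := integrable_abs_pow_gaussianReal 0 1
  have i2 := integrable_abs_pow_gaussianReal 0 2
  simp only [pow_one, sq_abs] at i1 i2
  have key : ∫ z in {z : ℝ | τ < |z|}, (z ^ 2 - (τ ^ 2 + 2)) ∂(gaussianReal 0 1) ≤
      ∫ z in {z : ℝ | τ < |z|}, 2 * (|z| * (|z| - τ) - 1) ∂(gaussianReal 0 1) := by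
    refine integral_mono ?_ ?_ fun z => ?_
    · exact (i2.sub (integrable_const _)).integrableOn
    · have : Integrable (fun z : ℝ => 2 * (z ^ 2 - τ * |z| - 1)) (gaussianReal 0 1) :=
        ((i2.sub (i1.const_mul τ)).sub (integrable_const _)).const_mul 2
      refine (this.congr (ae_of_all _ fun z => ?_)).integrableOn
      simp only [← sq_abs z]; ring
    · simp only [← sq_abs z]
      nlinarith [sq_nonneg (|z| - τ)]
  rw [integral_const_mul, hst, integral_sub i2.integrableOn (integrable_const _),
    setIntegral_const, smul_eq_mul, measureReal_def] at key
  linarith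

theorem setIntegral_pow_four_gaussianReal_le {τ : ℝ} (hτ : 1 ≤ τ) :
    ∫ z in {z : ℝ | τ < |z|}, z ^ 4 ∂(gaussianReal 0 1) ≤ 14 * τ ^ 4 * Real.exp (-τ ^ 2 / 2) := by
  have hst := setIntegral_gaussianReal_stein (by linarith : 0 ≤ τ)
    (Polynomial.X ^ 3 + Polynomial.C 3 * Polynomial.X + Polynomial.C 3)
  simp only [Polynomial.eval_add, Polynomial.eval_mul, Polynomial.eval_pow, Polynomial.eval_X,
    Polynomial.eval_C, Polynomial.derivative_add, Polynomial.derivative_X_pow,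
    Polynomial.derivative_mul, Polynomial.derivative_C, Polynomial.derivative_X, zero_mul,
    mul_one, zero_add, add_zero] at hst
  have i1 := integrable_abs_pow_gaussianReal 0 1
  have i4 := integrable_abs_pow_gaussianReal 0 4
  simp only [pow_one, Even.pow_abs, (by decide : Even 4)] at i1 i4
  have hS : MeasurableSet {z : ℝ | τ < |z|} := measurableSet_lt (by fun_prop) (by fun_prop)
  have key : ∫ z in {z : ℝ | τ < |z|}, z ^ 4 ∂(gaussianReal 0 1) ≤
      ∫ z in {z : ℝ | τ < |z|}, (|z| * (|z| ^ 3 + 3 * |z| + 3) -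
        (((3 : ℕ) : ℝ) * |z| ^ (3 - 1) + 3)) ∂(gaussianReal 0 1) := by
    refine setIntegral_mono_on i4.integrableOn ?_ hS fun z hz => ?_
    · have : Integrable (fun z : ℝ => z ^ 4 + 3 * |z| - 3) (gaussianReal 0 1) :=
        (i4.add (i1.const_mul 3)).sub (integrable_const _)
      refine (this.congr (ae_of_all _ fun z => ?_)).integrableOn
      simp only [← (by decide : Even 4).pow_abs z]; push_cast; ring
    · rw [← (by decide : Even 4).pow_abs z]
      have : 1 < |z| := hτ.trans_lt hz
      generalize |z| = y at this
      norm_num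
      nlinarith
  refine key.trans (hst.le.trans ?_)
  have hpdf : gaussianPDFReal 0 1 τ ≤ Real.exp (-τ ^ 2 / 2) := by
    rw [gaussianPDFReal_zero_one, (by ring : -(1 / 2) * τ ^ 2 = -τ ^ 2 / 2)]
    refine mul_le_of_le_one_left (Real.exp_pos _).le (inv_le_one_of_one_le₀ ?_)
    rw [Real.one_le_sqrt]
    linarith [Real.pi_gt_three]
  have h3 : τ ^ 3 + 3 * τ + 3 ≤ 7 * τ ^ 4 := by
    have h1 : τ ≤ τ ^ 4 := le_self_pow₀ hτ (by norm_num)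
    have h2 : τ ^ 3 ≤ τ ^ 4 := pow_le_pow_right₀ hτ (by norm_num)
    linarith
  have := mul_le_mul h3 hpdf (gaussianPDFReal_nonneg _ _ _) (by positivity)
  linarith

theorem gaussianReal_tail_pos (τ : ℝ) :
    0 < ((gaussianReal 0 1) {z : ℝ | τ < |z|}).toReal := by
  refine ENNReal.toReal_pos (fun h => ?_) (measure_ne_top _ _)
  have h0 := gaussianReal_absolutelyContinuous' 0 (one_ne_zero (α := NNReal)) h
  have h1 : volume (Set.Ioi τ) = 0 :=
    measure_mono_null (fun z (hz : τ < z) => hz.trans_le (le_abs_self z)) h0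
  simp at h1

theorem sq_le_nuTau {τ : ℝ} (hτ : 0 ≤ τ) : τ ^ 2 ≤ nuTau τ := by
  have hS : MeasurableSet {z : ℝ | τ < |z|} := measurableSet_lt (by fun_prop) (by fun_prop)
  have i2 : Integrable (fun z : ℝ => z ^ 2) (gaussianReal 0 1) := by
    simpa using integrable_abs_pow_gaussianReal 0 2
  rw [nuTau, le_div_iff₀ (gaussianReal_tail_pos τ), mul_comm]
  have := setIntegral_mono_on (μ := gaussianReal 0 1) (f := fun _ => τ ^ 2)
    (integrable_const _).integrableOn i2.integrableOn hS
    fun z (hz : τ < |z|) => by rw [← sq_abs z]; gcongr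
  rwa [setIntegral_const, smul_eq_mul, measureReal_def] at this

theorem nuTau_le {τ : ℝ} (hτ : 0 ≤ τ) : nuTau τ ≤ τ ^ 2 + 2 :=
  (div_le_iff₀ (gaussianReal_tail_pos τ)).2 (setIntegral_sq_gaussianReal_le hτ)

/-- The centred and truncated square `(z² - ν_τ) 1(|z| > τ)`. -/
noncomputable def truncSq (τ z : ℝ) : ℝ := (z ^ 2 - nuTau τ) * (if τ < |z| then (1 : ℝ) else 0)

theorem truncSq_eq_indicator (τ : ℝ) :
    truncSq τ = {z : ℝ | τ < |z|}.indicator fun z => z ^ 2 - nuTau τ := by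
  ext z
  by_cases hz : τ < |z| <;> simp [truncSq, hz]

@[fun_prop]
theorem measurable_truncSq (τ : ℝ) : Measurable (truncSq τ) := by
  rw [truncSq_eq_indicator]
  exact Measurable.indicator (by fun_prop) (measurableSet_lt (by fun_prop) (by fun_prop))

theorem sub_nuTau_le_truncSq {τ : ℝ} (hτ : 0 ≤ τ) (z : ℝ) : z ^ 2 - nuTau τ ≤ truncSq τ z := by
  by_cases hz : τ < |z|
  · simp [truncSq, hz]
  · have : z ^ 2 ≤ τ ^ 2 := sq_le_sq' (by linarith [neg_abs_le z]) (by linarith [le_abs_self z])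
    simp only [truncSq, hz, if_false, mul_zero]
    linarith [sq_le_nuTau hτ]

theorem memLp_truncSq (τ m : ℝ) : MemLp (truncSq τ) 2 (gaussianReal m 1) := by
  rw [truncSq_eq_indicator]
  refine MemLp.indicator (measurableSet_lt (by fun_prop) (by fun_prop))
    (MemLp.sub ?_ (memLp_const _))
  rw [memLp_two_iff_integrable_sq (by fun_prop)]
  refine (integrable_abs_pow_gaussianReal m 4).congr (ae_of_all _ fun z => ?_)
  simp only [(by decide : Even 4).pow_abs]
  ring

theorem integral_truncSq (τ : ℝ) : ∫ z, truncSq τ z ∂(gaussianReal 0 1) = 0 := by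
  have hS : MeasurableSet {z : ℝ | τ < |z|} := measurableSet_lt (by fun_prop) (by fun_prop)
  have i2 : Integrable (fun z : ℝ => z ^ 2) (gaussianReal 0 1) := by
    simpa using integrable_abs_pow_gaussianReal 0 2
  rw [truncSq_eq_indicator, integral_indicator hS,
    integral_sub i2.integrableOn (integrable_const _), setIntegral_const, smul_eq_mul,
    measureReal_def, nuTau, mul_div_cancel₀ _ (gaussianReal_tail_pos τ).ne', sub_self]

theorem variance_truncSq_le {τ : ℝ} (hτ : 1 ≤ τ) :
    Var[truncSq τ; gaussianReal 0 1] ≤ 56 * τ ^ 4 * Real.exp (-τ ^ 2 / 2) := by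
  have hτ0 : 0 ≤ τ := by linarith
  have hS : MeasurableSet {z : ℝ | τ < |z|} := measurableSet_lt (by fun_prop) (by fun_prop)
  have i4 : Integrable (fun z : ℝ => z ^ 4) (gaussianReal 0 1) := by
    simpa only [(by decide : Even 4).pow_abs] using integrable_abs_pow_gaussianReal 0 4
  refine (variance_le_expectation_sq (by fun_prop)).trans ?_
  have key : ∫ z, (truncSq τ ^ 2) z ∂(gaussianReal 0 1) ≤
      ∫ z, {z : ℝ | τ < |z|}.indicator (fun z => 4 * z ^ 4) z ∂(gaussianReal 0 1) := by
    refine integral_mono (memLp_truncSq τ 0).integrable_sq ((i4.const_mul 4).indicator hS)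
      fun z => ?_
    simp only [Pi.pow_apply, truncSq_eq_indicator]
    by_cases hz : τ < |z|
    · simp only [Set.indicator, Set.mem_ofPred_eq, hz, if_true]
      have h1 : τ ^ 2 ≤ z ^ 2 := by rw [← sq_abs z]; gcongr
      have h2 := nuTau_le hτ0
      have h3 := sq_le_nuTau hτ0
      have h4 : 1 ≤ τ ^ 2 := one_le_pow₀ hτ
      have : (z ^ 2 - nuTau τ) ^ 2 ≤ (2 * z ^ 2) ^ 2 := sq_le_sq' (by linarith) (by linarith)
      linarith
    · simp [Set.indicator, hz]
  refine key.trans ?_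
  rw [integral_indicator hS, integral_const_mul]
  linarith [setIntegral_pow_four_gaussianReal_le hτ]

theorem measureReal_le_abs_sum_truncSq_le {ι : Type*} [Fintype ι] (θ : ι → ℝ) (A : Finset ι)
    (hA : ∀ j ∈ A, θ j = 0) {τ t : ℝ} (hτ : 1 ≤ τ) (ht : 0 < t) :
    (Measure.pi fun j => gaussianReal (θ j) 1).real {w | t ≤ |∑ j ∈ A, truncSq τ (w j)|} ≤
      A.card * (56 * τ ^ 4 * Real.exp (-τ ^ 2 / 2)) / t ^ 2 := by
  have hmp := fun j => measurePreserving_eval (fun j => gaussianReal (θ j) 1) j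
  have hL : ∀ j ∈ A, MemLp (fun w : ι → ℝ => truncSq τ (w j)) 2
      (Measure.pi fun j => gaussianReal (θ j) 1) := fun j _ =>
    (memLp_truncSq τ (θ j)).comp_measurePreserving (hmp j)
  have hind : iIndepFun (fun (j : ι) (w : ι → ℝ) => truncSq τ (w j))
      (Measure.pi fun j => gaussianReal (θ j) 1) :=
    iIndepFun_pi (X := fun _ => truncSq τ) fun j => by fun_prop
  have hvar : Var[∑ j ∈ A, fun w : ι → ℝ => truncSq τ (w j);
      Measure.pi fun j => gaussianReal (θ j) 1] ≤
      A.card * (56 * τ ^ 4 * Real.exp (-τ ^ 2 / 2)) := by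
    rw [IndepFun.variance_sum hL fun i _ j _ hij => hind.indepFun hij, ← nsmul_eq_mul]
    refine Finset.sum_le_card_nsmul _ _ _ fun j hj => ?_
    have h := variance_map (X := truncSq τ) (Y := fun w : ι → ℝ => w j)
      (μ := Measure.pi fun j => gaussianReal (θ j) 1) (by fun_prop)
      (measurable_pi_apply j).aemeasurable
    rw [(hmp j).map_eq, hA j hj] at h
    exact h.symm.le.trans (variance_truncSq_le hτ)
  have hmean : ∫ w, (∑ j ∈ A, fun w : ι → ℝ => truncSq τ (w j)) w
      ∂(Measure.pi fun j => gaussianReal (θ j) 1) = 0 := by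
    simp only [Finset.sum_apply]
    rw [integral_finsetSum _ fun j hj => (hL j hj).integrable one_le_two]
    refine Finset.sum_eq_zero fun j hj => ?_
    rw [integral_comp_eval (μ := fun j => gaussianReal (θ j) 1) (by fun_prop), hA j hj,
      integral_truncSq]
  have hcheb := meas_ge_le_variance_div_sq (memLp_finsetSum' A hL) ht
  rw [hmean] at hcheb
  simp only [Finset.sum_apply, sub_zero] at hcheb
  refine (ENNReal.toReal_le_of_le_ofReal (div_nonneg (variance_nonneg _ _) (by positivity))
    hcheb).trans ?_
  gcongr

theorem measureReal_le_sum_sq_sub_le {ι : Type*} [Fintype ι] (θ : ι → ℝ) (A : Finset ι)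
    {t : ℝ} (ht : 0 < t) :
    (Measure.pi fun j => gaussianReal (θ j) 1).real {w | t ≤ ∑ j ∈ A, (w j - θ j) ^ 2} ≤
      A.card / t := by
  have hi : ∀ m : ℝ, Integrable (fun z : ℝ => (z - m) ^ 2) (gaussianReal m 1) := fun m =>
    ((memLp_id_gaussianReal 2).sub (memLp_const m)).integrable_sq
  have hi' : ∀ j ∈ A, Integrable (fun w : ι → ℝ => (w j - θ j) ^ 2)
      (Measure.pi fun j => gaussianReal (θ j) 1) := fun j _ =>
    integrable_comp_eval (μ := fun j => gaussianReal (θ j) 1) (hi (θ j))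
  have h1 : ∀ m : ℝ, ∫ z, (z - m) ^ 2 ∂(gaussianReal m 1) = 1 := fun m => by
    have h := variance_eq_integral (μ := gaussianReal m 1) (X := fun z => z) (by fun_prop)
    rw [variance_fun_id_gaussianReal, integral_id_gaussianReal] at h
    simpa using h.symm
  have hmarkov := mul_meas_ge_le_integral_of_nonneg
    (μ := Measure.pi fun j => gaussianReal (θ j) 1) (f := fun w => ∑ j ∈ A, (w j - θ j) ^ 2)
    (ae_of_all _ fun w => Finset.sum_nonneg fun j _ => sq_nonneg _)
    (integrable_finsetSum A hi') t
  rw [integral_finsetSum A hi'] at hmarkov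
  have hone : ∀ j ∈ A, ∫ w : ι → ℝ, (w j - θ j) ^ 2
      ∂(Measure.pi fun j => gaussianReal (θ j) 1) = 1 := fun j _ => by
    rw [integral_comp_eval (μ := fun j => gaussianReal (θ j) 1) (f := fun z => (z - θ j) ^ 2)
      (by fun_prop), h1]
  rw [Finset.sum_congr rfl hone, Finset.sum_const, nsmul_eq_mul, mul_one] at hmarkov
  rw [le_div_iff₀ ht]
  linarith

theorem measurableSet_decide_lt_sum_truncSq {ι : Type*} [Fintype ι] (τ t : ℝ) (b : Bool) :
    MeasurableSet {w : ι → ℝ | decide (t < ∑ j, truncSq τ (w j)) = b} := by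
  have h : MeasurableSet {w : ι → ℝ | t < ∑ j, truncSq τ (w j)} :=
    measurableSet_lt (by fun_prop) (by fun_prop)
  cases b
  · simpa [Set.compl_def] using h.compl
  · simpa using h

theorem le_scaled_column_sum {d₁ d₂ : ℕ} {s₁ : ℕ} {μ : ℝ} {X : Fin d₁ → Fin d₂ → ℝ}
    {S₁ : Finset (Fin d₁)} (hS₁ : S₁.card = s₁) {j : Fin d₂} (hμ : ∀ i ∈ S₁, μ ≤ X i j)
    (h0 : ∀ i ∉ S₁, X i j = 0) :
    1 / √(d₁ : ℝ) * (s₁ * μ) ≤ 1 / √(d₁ : ℝ) * ∑ i, X i j := by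
  gcongr
  rw [← Finset.sum_subset (Finset.subset_univ S₁) fun i _ hi => h0 i hi, ← hS₁, ← nsmul_eq_mul]
  exact Finset.card_nsmul_le_sum _ _ _ hμ

/-- Analysis of the truncated χ² test (Lemma B.3). -/
theorem truncated_chi_square_test (α c : ℝ) (hα0 : 0 < α) (hα1 : α < 1)
    (hc : 0 < c) :
    ∃ Cμ Ch : ℝ, 0 < Cμ ∧ 0 < Ch ∧
      ∀ (d₁ d₂ s₁ s₂ : ℕ), 0 < d₁ → 0 < d₂ →
        1 ≤ s₁ → s₁ ≤ d₁ → 1 ≤ s₂ → s₂ ≤ d₂ →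
        c ≤ (d₂ : ℝ) / (s₂ : ℝ) ^ 2 →
        ∀ μ : ℝ, 0 < μ →
          Cμ * ((d₁ : ℝ) / (s₁ : ℝ) ^ 2) *
              Real.log (1 + (d₂ : ℝ) / (s₂ : ℝ) ^ 2) ≤ μ ^ 2 →
          ∀ τ : ℝ,
            τ = Real.sqrt (max (1 / Real.log (1 + c)) 2 *
              Real.log (1 + (d₂ : ℝ) / (s₂ : ℝ) ^ 2)) →
            risk d₁ d₂ s₁ s₂ μ
              (fun Y => decide
                (Ch * (s₂ : ℝ) * Real.log (1 + (d₂ : ℝ) / (s₂ : ℝ) ^ 2) <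
                  ∑ j, (((1 / Real.sqrt (d₁ : ℝ)) * ∑ i, Y i j) ^ 2 - nuTau τ) *
                    (if τ < |(1 / Real.sqrt (d₁ : ℝ)) * ∑ i, Y i j| then (1 : ℝ)
                      else 0))) ≤ α := by
  set C₀ : ℝ := max (1 / Real.log (1 + c)) 2 with hC₀
  have hC₀2 : 2 ≤ C₀ := le_max_right _ _
  have hℓ : 0 < Real.log (1 + c) := Real.log_pos (by linarith)
  set Ch : ℝ := C₀ * √(224 / α) with hCh
  have hChpos : 0 < Ch := by positivity
  refine ⟨4 * Ch + 6 * C₀ + 8 / α * C₀, Ch, by positivity, hChpos, ?_⟩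
  intro d₁ d₂ s₁ s₂ hd₁ hd₂ hs₁ _ hs₂ _ hcd μ hμ hμ2 τ hτ
  set L : ℝ := Real.log (1 + (d₂ : ℝ) / (s₂ : ℝ) ^ 2) with hL
  have hd₁' : (0 : ℝ) < d₁ := by exact_mod_cast hd₁
  have hs₁' : (0 : ℝ) < s₁ := by exact_mod_cast hs₁
  have hs₂' : (0 : ℝ) < s₂ := by exact_mod_cast hs₂
  have hLℓ : Real.log (1 + c) ≤ L := Real.log_le_log (by linarith) (by linarith)
  have hLpos : 0 < L := hℓ.trans_le hLℓ
  have hCL : 1 ≤ C₀ * L := by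
    have h1 : 1 / Real.log (1 + c) * Real.log (1 + c) ≤ C₀ * L := by
      gcongr
      exact le_max_left _ _
    rwa [one_div_mul_cancel hℓ.ne'] at h1
  have hτ2 : τ ^ 2 = C₀ * L := by rw [hτ, Real.sq_sqrt (by linarith)]
  have hτ1 : 1 ≤ τ := by rw [hτ]; exact Real.one_le_sqrt.2 hCL
  have hτ0 : 0 ≤ τ := by linarith
  set t : ℝ := Ch * s₂ * L with ht
  have htpos : 0 < t := by positivity
  -- the tail weight `d₂ exp (-τ² / 2)` is at most `s₂²`
  have hexp : (d₂ : ℝ) * Real.exp (-τ ^ 2 / 2) ≤ (s₂ : ℝ) ^ 2 := by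
    have h1 : Real.exp (-τ ^ 2 / 2) ≤ (1 + (d₂ : ℝ) / (s₂ : ℝ) ^ 2)⁻¹ := by
      rw [← Real.exp_log (show 0 < 1 + (d₂ : ℝ) / (s₂ : ℝ) ^ 2 by positivity), ← Real.exp_neg,
        Real.exp_le_exp, ← hL, hτ2]
      nlinarith
    calc (d₂ : ℝ) * Real.exp (-τ ^ 2 / 2)
        ≤ d₂ * (1 + (d₂ : ℝ) / (s₂ : ℝ) ^ 2)⁻¹ := by gcongr
      _ ≤ (s₂ : ℝ) ^ 2 := by
        rw [← div_eq_mul_inv, div_le_iff₀ (by positivity), mul_add,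
          mul_div_cancel₀ _ (by positivity)]
        nlinarith
  have hcheb : ∀ (θ : Fin d₂ → ℝ) (A : Finset (Fin d₂)), (∀ j ∈ A, θ j = 0) →
      (Measure.pi fun j => gaussianReal (θ j) 1).real
        {w | t ≤ |∑ j ∈ A, truncSq τ (w j)|} ≤ α / 4 := by
    intro θ A hA
    refine (measureReal_le_abs_sum_truncSq_le θ A hA hτ1 htpos).trans ?_
    rw [div_le_iff₀ (by positivity)]
    have hcard : (A.card : ℝ) ≤ d₂ := by
      exact_mod_cast (Finset.card_le_univ A).trans_eq (Fintype.card_fin d₂)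
    have ht2 : α / 4 * t ^ 2 = 56 * (C₀ * L) ^ 2 * (s₂ : ℝ) ^ 2 := by
      have : √(224 / α) ^ 2 = 224 / α := Real.sq_sqrt (by positivity)
      rw [ht, hCh, mul_pow, mul_pow, mul_pow, this]
      field_simp
      ring
    rw [ht2, ← hτ2]
    calc (A.card : ℝ) * (56 * τ ^ 4 * Real.exp (-τ ^ 2 / 2))
        ≤ d₂ * (56 * τ ^ 4 * Real.exp (-τ ^ 2 / 2)) := by gcongr
      _ = 56 * (τ ^ 2) ^ 2 * (d₂ * Real.exp (-τ ^ 2 / 2)) := by ring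
      _ ≤ 56 * (τ ^ 2) ^ 2 * (s₂ : ℝ) ^ 2 := by gcongr
  have hlaw : ∀ (X : Fin d₁ → Fin d₂ → ℝ) (b : Bool),
      (Pmeas d₁ d₂ X {y | decide (t < ∑ j, truncSq τ (1 / √(d₁ : ℝ) * ∑ i, y i j)) = b}).toReal =
      (Measure.pi fun j => gaussianReal (1 / √(d₁ : ℝ) * ∑ i, X i j) 1).real
        {w | decide (t < ∑ j, truncSq τ (w j)) = b} := by
    intro X b
    rw [measureReal_def, ← Pmeas_map_scaled_column_sums hd₁, Measure.map_apply (by fun_prop)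
      (measurableSet_decide_lt_sum_truncSq τ t b)]
    rfl
  change (Pmeas d₁ d₂ 0
      {y | decide (t < ∑ j, truncSq τ (1 / √(d₁ : ℝ) * ∑ i, y i j)) = true}).toReal +
    ⨆ X ∈ Theta d₁ d₂ s₁ s₂ μ, (Pmeas d₁ d₂ X
      {y | decide (t < ∑ j, truncSq τ (1 / √(d₁ : ℝ) * ∑ i, y i j)) = false}).toReal ≤ α
  have hnull : (Pmeas d₁ d₂ 0
      {y | decide (t < ∑ j, truncSq τ (1 / √(d₁ : ℝ) * ∑ i, y i j)) = true}).toReal ≤ α / 4 := by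
    rw [hlaw]
    refine (measureReal_mono fun w hw => ?_).trans (hcheb _ Finset.univ fun j _ => by simp)
    simp only [Set.mem_ofPred_eq, decide_eq_true_eq] at hw
    exact hw.le.trans (le_abs_self _)
  have halt : ∀ X ∈ Theta d₁ d₂ s₁ s₂ μ, (Pmeas d₁ d₂ X
      {y | decide (t < ∑ j, truncSq τ (1 / √(d₁ : ℝ) * ∑ i, y i j)) = false}).toReal ≤ α / 2 := by
    rintro X ⟨S₁, S₂, hS₁, hS₂, hXμ, hX0⟩
    rw [hlaw]
    set θ : Fin d₂ → ℝ := fun j => 1 / √(d₁ : ℝ) * ∑ i, X i j with hθ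
    have hθ0 : ∀ j ∈ S₂ᶜ, θ j = 0 := fun j hj => by
      simp only [hθ]
      rw [Finset.sum_eq_zero fun i _ => hX0 i j fun h => Finset.mem_compl.1 hj h.2, mul_zero]
    have hθ2 : ∀ j ∈ S₂, (4 * Ch + 6 * C₀ + 8 / α * C₀) * L ≤ θ j ^ 2 := fun j hj => by
      have h1 := le_scaled_column_sum hS₁ (fun i hi => hXμ i j hi hj)
        fun i hi => hX0 i j fun h => hi h.1
      refine le_trans ?_ (pow_le_pow_left₀ (by positivity) h1 2)
      rw [mul_pow, mul_pow, div_pow, Real.sq_sqrt hd₁'.le, one_pow]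
      calc (4 * Ch + 6 * C₀ + 8 / α * C₀) * L
          = 1 / d₁ * (s₁ ^ 2 *
            ((4 * Ch + 6 * C₀ + 8 / α * C₀) * ((d₁ : ℝ) / (s₁ : ℝ) ^ 2) * L)) := by
            field_simp
        _ ≤ 1 / d₁ * (s₁ ^ 2 * μ ^ 2) := by gcongr
    have hmarkov : (Measure.pi fun j => gaussianReal (θ j) 1).real
        {w | 4 / α * s₂ ≤ ∑ j ∈ S₂, (w j - θ j) ^ 2} ≤ α / 4 := by
      refine (measureReal_le_sum_sq_sub_le θ S₂ (by positivity)).trans_eq ?_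
      rw [hS₂]
      field_simp
    have hsub : {w : Fin d₂ → ℝ | decide (t < ∑ j, truncSq τ (w j)) = false} ⊆
        {w | t ≤ |∑ j ∈ S₂ᶜ, truncSq τ (w j)|} ∪
          {w | 4 / α * s₂ ≤ ∑ j ∈ S₂, (w j - θ j) ^ 2} := by
      intro w hw
      simp only [Set.mem_ofPred_eq, decide_eq_false_iff_not, not_lt] at hw
      by_contra hcon
      simp only [Set.mem_union, Set.mem_ofPred_eq, not_or, not_le] at hcon
      obtain ⟨h1, h2⟩ := hcon
      have h3 := (abs_lt.1 h1).1
      rw [← Finset.sum_add_sum_compl S₂] at hw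
      have h4 : ∑ j ∈ S₂, (((4 * Ch + 6 * C₀ + 8 / α * C₀) * L) / 2 - nuTau τ -
          (w j - θ j) ^ 2) ≤ ∑ j ∈ S₂, truncSq τ (w j) := by
        refine Finset.sum_le_sum fun j hj => ?_
        have h5 := sub_nuTau_le_truncSq hτ0 (w j)
        have h6 := hθ2 j hj
        nlinarith [sq_nonneg (θ j + 2 * (w j - θ j))]
      rw [Finset.sum_sub_distrib, Finset.sum_const, hS₂, nsmul_eq_mul] at h4
      have hν := nuTau_le hτ0
      have h7 : 4 / α * 1 ≤ 4 / α * (C₀ * L) := by gcongr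
      have h8 : 2 * Ch * L + 4 / α ≤ (4 * Ch + 6 * C₀ + 8 / α * C₀) * L / 2 - nuTau τ := by
        rw [show 8 / α = 2 * (4 / α) by ring]
        linarith
      have h9 := mul_le_mul_of_nonneg_left h8 hs₂'.le
      linarith
    calc _ ≤ _ := measureReal_mono hsub
      _ ≤ _ := measureReal_union_le _ _
      _ ≤ α / 4 + α / 4 := add_le_add (hcheb θ S₂ᶜ hθ0) hmarkov
      _ = α / 2 := by ring
  have hsup : ⨆ X ∈ Theta d₁ d₂ s₁ s₂ μ, (Pmeas d₁ d₂ X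
      {y | decide (t < ∑ j, truncSq τ (1 / √(d₁ : ℝ) * ∑ i, y i j)) = false}).toReal ≤ α / 2 :=
    Real.iSup_le (fun X => Real.iSup_le (fun hX => halt X hX) (by positivity)) (by positivity)
  linarith
end

section
/- (Principal term of the second moment.) Let C > 0 and α > 0 be given. There exists a constant c_μ > 0 depending only on C and α such that for all positive integers d₁, d₂ and integers 1 ≤ s₁ ≤ d₁, 1 ≤ s₂ ≤ d₂ with s₁² ≥ d₁/C, and every μ > 0 with μ² ≤ c_μ·(d₁/s₁²)·log(1 + d₂/s₂²), it holds that E[ exp(μ²·X·Y)·1(X ≤ C·s₁²/d₁) ] < 1 + α. -/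
/-- The binomial point mass: P(X = k) for X ~ Binomial(n, p). -/
noncomputable def binomP (n : ℕ) (p : ℝ) (k : ℕ) : ℝ :=
  (n.choose k : ℝ) * p ^ k * (1 - p) ^ (n - k)

/-- Expectation E[f(X,Y)] for independent X ~ Binomial(s₁, s₁/d₁) and
Y ~ Binomial(s₂, s₂/d₂). -/
noncomputable def Eexp (s₁ s₂ d₁ d₂ : ℕ) (f : ℕ → ℕ → ℝ) : ℝ :=
  ∑ k ∈ Finset.range (s₁ + 1), ∑ l ∈ Finset.range (s₂ + 1),
    binomP s₁ ((s₁ : ℝ) / (d₁ : ℝ)) k * binomP s₂ ((s₂ : ℝ) / (d₂ : ℝ)) l * f k l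

theorem binomP_nonneg {p : ℝ} (hp₀ : 0 ≤ p) (hp₁ : p ≤ 1) (n k : ℕ) : 0 ≤ binomP n p k := by
  have : 0 ≤ 1 - p := sub_nonneg.2 hp₁
  unfold binomP
  positivity

/-- The moment generating function of the binomial distribution. -/
theorem sum_binomP_mul_exp (n : ℕ) (p x : ℝ) :
    ∑ l ∈ Finset.range (n + 1), binomP n p l * Real.exp (x * l) =
      (p * Real.exp x + (1 - p)) ^ n := by
  rw [add_pow]
  refine Finset.sum_congr rfl fun l _ => ?_
  rw [binomP, mul_comm x, Real.exp_nat_mul, mul_pow]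
  ring

theorem sum_binomP (n : ℕ) (p : ℝ) : ∑ k ∈ Finset.range (n + 1), binomP n p k = 1 := by
  simpa using sum_binomP_mul_exp n p 0

/-- The binomial moment generating function is at most the Poisson one with the same mean. -/
theorem sum_binomP_mul_exp_le {p : ℝ} (hp₀ : 0 ≤ p) (hp₁ : p ≤ 1) (n : ℕ) (x : ℝ) :
    ∑ l ∈ Finset.range (n + 1), binomP n p l * Real.exp (x * l) ≤
      Real.exp (n * p * (Real.exp x - 1)) := by
  have h₁ : 0 ≤ 1 - p := sub_nonneg.2 hp₁
  rw [sum_binomP_mul_exp, mul_assoc (n : ℝ), Real.exp_nat_mul]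
  gcongr
  linarith [Real.add_one_le_exp (p * (Real.exp x - 1))]

/-- If `x ≤ t * log (1 + 1 / m)` with `m` the mean and `0 ≤ t ≤ 1`, the binomial moment generating
function at `x` is at most `exp t`. -/
theorem sum_binomP_mul_exp_le_exp {n : ℕ} {p t x : ℝ} (hn : 0 < n) (hp₀ : 0 < p) (hp₁ : p ≤ 1)
    (ht₀ : 0 ≤ t) (ht₁ : t ≤ 1) (hx : x ≤ t * Real.log (1 + (n * p)⁻¹)) :
    ∑ l ∈ Finset.range (n + 1), binomP n p l * Real.exp (x * l) ≤ Real.exp t := by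
  refine (sum_binomP_mul_exp_le hp₀.le hp₁ n x).trans (Real.exp_le_exp.2 ?_)
  have hm : 0 < n * p := by positivity
  have hi : 0 < (n * p)⁻¹ := inv_pos.2 hm
  have hbern : Real.exp x ≤ 1 + t * (n * p)⁻¹ := by
    refine (Real.exp_le_exp.2 hx).trans ?_
    rw [mul_comm, ← Real.rpow_def_of_pos (by linarith)]
    exact rpow_one_add_le_one_add_mul_self (by linarith) ht₀ ht₁
  calc n * p * (Real.exp x - 1) ≤ n * p * (t * (n * p)⁻¹) := by gcongr; linarith
    _ = t := by field_simp

/-- Principal term of the second moment (Lemma A.1). -/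
theorem principal_term (C α : ℝ) (hC : 0 < C) (hα : 0 < α) :
    ∃ cμ : ℝ, 0 < cμ ∧
      ∀ (d₁ d₂ s₁ s₂ : ℕ), 0 < d₁ → 0 < d₂ →
        1 ≤ s₁ → s₁ ≤ d₁ → 1 ≤ s₂ → s₂ ≤ d₂ →
        (d₁ : ℝ) / C ≤ (s₁ : ℝ) ^ 2 →
        ∀ μ : ℝ, 0 < μ →
          μ ^ 2 ≤ cμ * ((d₁ : ℝ) / (s₁ : ℝ) ^ 2) *
            Real.log (1 + (d₂ : ℝ) / (s₂ : ℝ) ^ 2) →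
          Eexp s₁ s₂ d₁ d₂ (fun k l =>
            Real.exp (μ ^ 2 * (k : ℝ) * (l : ℝ)) *
              (if (k : ℝ) ≤ C * (s₁ : ℝ) ^ 2 / (d₁ : ℝ) then (1 : ℝ) else 0)) <
          1 + α := by
  have hlog : 0 < Real.log (1 + α) := Real.log_pos (by linarith)
  obtain ⟨t, ht₀, ht⟩ := exists_between (lt_min one_pos hlog)
  obtain ⟨ht₁, htα⟩ := lt_min_iff.1 ht
  refine ⟨t / C, by positivity, ?_⟩
  intro d₁ d₂ s₁ s₂ hd₁ hd₂ hs₁ hsd₁ hs₂ hsd₂ _ μ _ hμ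
  have hd₁' : (0 : ℝ) < d₁ := by exact_mod_cast hd₁
  have hd₂' : (0 : ℝ) < d₂ := by exact_mod_cast hd₂
  have hs₁' : (0 : ℝ) < s₁ := by exact_mod_cast hs₁
  have hs₂' : (0 : ℝ) < s₂ := by exact_mod_cast hs₂
  have hp₁ : (s₁ : ℝ) / d₁ ≤ 1 := (div_le_one hd₁').2 (by exact_mod_cast hsd₁)
  have hp₂ : (s₂ : ℝ) / d₂ ≤ 1 := (div_le_one hd₂').2 (by exact_mod_cast hsd₂)
  have hmean : (d₂ : ℝ) / (s₂ : ℝ) ^ 2 = ((s₂ : ℝ) * ((s₂ : ℝ) / d₂))⁻¹ := by field_simp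
  rw [hmean] at hμ
  have hbound : ∀ k : ℕ, ∑ l ∈ Finset.range (s₂ + 1), binomP s₂ ((s₂ : ℝ) / d₂) l *
      (Real.exp (μ ^ 2 * k * l) *
        (if (k : ℝ) ≤ C * (s₁ : ℝ) ^ 2 / d₁ then (1 : ℝ) else 0)) ≤ Real.exp t := by
    intro k
    split_ifs with hk
    · simp only [mul_one]
      refine sum_binomP_mul_exp_le_exp hs₂ (by positivity) hp₂ ht₀.le ht₁.le ?_
      calc μ ^ 2 * k ≤ μ ^ 2 * (C * (s₁ : ℝ) ^ 2 / d₁) := by gcongr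
        _ ≤ t / C * ((d₁ : ℝ) / (s₁ : ℝ) ^ 2) *
              Real.log (1 + ((s₂ : ℝ) * ((s₂ : ℝ) / d₂))⁻¹) * (C * (s₁ : ℝ) ^ 2 / d₁) := by
            gcongr
        _ = t * Real.log (1 + ((s₂ : ℝ) * ((s₂ : ℝ) / d₂))⁻¹) := by
            generalize Real.log _ = L
            field_simp
    · simpa using (Real.exp_pos t).le
  calc Eexp s₁ s₂ d₁ d₂ _ ≤
        ∑ k ∈ Finset.range (s₁ + 1), binomP s₁ ((s₁ : ℝ) / d₁) k * Real.exp t := by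
        refine Finset.sum_le_sum fun k _ => ?_
        simp only [mul_assoc (binomP s₁ _ k), ← Finset.mul_sum]
        exact mul_le_mul_of_nonneg_left (hbound k) (binomP_nonneg (by positivity) hp₁ _ _)
    _ = Real.exp t := by rw [← Finset.sum_mul, sum_binomP, one_mul]
    _ < 1 + α := (Real.lt_log_iff_exp_lt (by linarith)).1 htα
end
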